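/- Let A be the monomial algebra on 13 generators defined below and K the trivial A-module. Then there exist a class γ ∈ Extᴬ²(K,K) and a class e ∈ Extᴬ¹(K,K) whose Yoneda product γe ∈ Extᴬ³(K,K) is nonzero. -/

import Mathlib

/-!
Let `K` be a field and `V` a 13-dimensional `K`-vector space with basis
`{m,n,p,q,r,s,t,u,v,w,x,y,z}`.  Let `A = T(V)/I` be the quotient of the free
(tensor) algebra on `V` by the two-sided ideal generated by the nine monomials
`mn²p, n²pqr, npqrs, pqrst, stu, tuvwx, uvwxy, vwxy², xy²z`, and regard `K` as
the trivial left `A`-module via the augmentation sending every generator to `0`.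
-/

open CategoryTheory

/-- The thirteen generators `m,n,p,q,r,s,t,u,v,w,x,y,z` of the algebra `A`. -/
inductive Gen : Type
  | m | n | p | q | r | s | t | u | v | w | x | y | z

variable (K : Type) [Field K]

open Gen

/-- The generator `i`, as an element of the tensor algebra `T(V)`. -/
noncomputable def g (i : Gen) : FreeAlgebra K Gen := FreeAlgebra.ι K i

/-- The relation identifying each of the nine defining monomials with `0`;
the quotient of `T(V)` by this relation is exactly `T(V)/I` where `I` is the
two-sided ideal generated by the nine monomials. -/
inductive MonRel : FreeAlgebra K Gen → FreeAlgebra K Gen → Prop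
  | mnnp : MonRel (g K m * g K n * g K n * g K p) 0
  | nnpqr : MonRel (g K n * g K n * g K p * g K q * g K r) 0
  | npqrs : MonRel (g K n * g K p * g K q * g K r * g K s) 0
  | pqrst : MonRel (g K p * g K q * g K r * g K s * g K t) 0
  | stu : MonRel (g K s * g K t * g K u) 0
  | tuvwx : MonRel (g K t * g K u * g K v * g K w * g K x) 0
  | uvwxy : MonRel (g K u * g K v * g K w * g K x * g K y) 0
  | vwxyy : MonRel (g K v * g K w * g K x * g K y * g K y) 0
  | xyyz : MonRel (g K x * g K y * g K y * g K z) 0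

/-- The monomial algebra `A = T(V)/I`. -/
noncomputable abbrev A : Type := RingQuot (MonRel K)

/-- The augmentation `A →ₐ[K] K`, sending every generator to `0`. -/
noncomputable def aug : A K →ₐ[K] K :=
  RingQuot.liftAlgHom K ⟨FreeAlgebra.lift K (fun _ => (0 : K)), by
    rintro x y h
    induction h <;> simp [g]⟩

/-- `K`, regarded as the trivial left `A`-module via the augmentation. -/
noncomputable def KMod : ModuleCat.{0} (A K) :=
  letI : Module (A K) K := Module.compHom K (aug K).toRingHom
  ModuleCat.of (A K) K

noncomputable local instance instDC : HasDerivedCategory.{1} (ModuleCat.{0} (A K)) :=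
  HasDerivedCategory.standard _

local instance instHE : HasExt.{1} (ModuleCat.{0} (A K)) :=
  @hasExt_of_hasDerivedCategory.{1, 0, 1} (ModuleCat.{0} (A K)) _ _ (instDC K)

/-- The Ext group `Extᴬⁿ(K, K)`; the Yoneda product of `a : E K i` and
`b : E K j` is given by the composition `a.comp b : E K (i + j)`. -/
noncomputable abbrev E (n : ℕ) : Type 1 := Abelian.Ext (KMod K) (KMod K) n


open Abelian in
/-- If a Yoneda product of three extension classes vanishes, and the first two extensions receive
compatible maps from a presentation by projectives, then the induced map out of the second syzygy
lifts along the third extension. -/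
theorem exists_lift_of_extClass_comp_eq_zero {C : Type*} [Category* C] [Abelian C] [HasExt C]
    {X Y₀ Y₁ Y₂ Z₁ Z₂ Z₃ J P N P' : C}
    {i₀ : Z₁ ⟶ Y₀} {p₀ : Y₀ ⟶ X} {w₀ : i₀ ≫ p₀ = 0} (h₀ : (ShortComplex.mk i₀ p₀ w₀).ShortExact)
    {i₁ : Z₂ ⟶ Y₁} {p₁ : Y₁ ⟶ Z₁} {w₁ : i₁ ≫ p₁ = 0} (h₁ : (ShortComplex.mk i₁ p₁ w₁).ShortExact)
    {i₂ : Z₃ ⟶ Y₂} {p₂ : Y₂ ⟶ Z₂} {w₂ : i₂ ≫ p₂ = 0} (h₂ : (ShortComplex.mk i₂ p₂ w₂).ShortExact)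
    {j : J ⟶ P} {q : P ⟶ N} {w : j ≫ q = 0} (h : (ShortComplex.mk j q w).ShortExact)
    [Projective P] [Projective P'] (a : N ⟶ P') (b : P' ⟶ Y₀) (φ : J ⟶ Z₂) (ψ : P ⟶ Y₁)
    (f : N ⟶ Z₁) (hφ : φ ≫ i₁ = j ≫ ψ) (hf : ψ ≫ p₁ = q ≫ f) (hab : f ≫ i₀ = a ≫ b)
    (hzero : ((h₀.extClass.comp h₁.extClass (by norm_num : 1 + 1 = 2)).comp h₂.extClass
      (by norm_num : 2 + 1 = 3)) = 0) :
    ∃ χ : J ⟶ Y₂, χ ≫ p₂ = φ := by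
  have nat := ShortComplex.ShortExact.extClass_naturality h h₁
    { τ₁ := φ, τ₂ := ψ, τ₃ := f, comm₁₂ := hφ, comm₂₃ := hf }
  dsimp only at nat
  rw [Ext.comp_assoc (a₂₃ := 2) _ _ _ _ (by norm_num) (by norm_num)] at hzero
  obtain ⟨ζ, hζ⟩ := Ext.contravariant_sequence_exact₁ h₀ _ _ _ hzero
  dsimp only at ζ hζ
  have h1 : (Ext.mk₀ f).comp (h₁.extClass.comp h₂.extClass (by norm_num : 1 + 1 = 2))
      (zero_add 2) = 0 := by
    rw [← hζ, Ext.mk₀_comp_mk₀_assoc, hab, ← Ext.mk₀_comp_mk₀_assoc,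
      Ext.eq_zero_of_projective ((Ext.mk₀ b).comp ζ (zero_add 2)), Ext.comp_zero]
  have h2 : h.extClass.comp ((Ext.mk₀ φ).comp h₂.extClass (zero_add 1))
      (by norm_num : 1 + 1 = 2) = 0 := by
    rw [← Ext.comp_assoc (a₁₂ := 1) _ _ _ (by norm_num) (by norm_num) (by norm_num), nat,
      Ext.comp_assoc (a₂₃ := 2) _ _ _ (by norm_num) (by norm_num) (by norm_num), h1]
  obtain ⟨ξ, hξ⟩ := Ext.contravariant_sequence_exact₁ h _ _ _ h2
  dsimp only at ξ hξ
  rw [Ext.eq_zero_of_projective ξ, Ext.comp_zero] at hξ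
  obtain ⟨χ, hχ⟩ := Ext.covariant_sequence_exact₃ J h₂ (Ext.mk₀ φ) (zero_add 1) hξ.symm
  obtain ⟨χ, rfl⟩ := (Ext.mk₀_bijective J Y₂).2 χ
  dsimp only at hχ
  rw [Ext.mk₀_comp_mk₀] at hχ
  exact ⟨χ, (Ext.mk₀_bijective _ _).1 hχ⟩

/-- The generator `i`, as an element of `A`. -/
noncomputable def gen (i : Gen) : A K := RingQuot.mkAlgHom K (MonRel K) (g K i)

theorem aug_gen (i : Gen) : aug K (gen K i) = 0 := by
  simp [aug, gen, g]

section

variable {K}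

theorem A.induction {P : A K → Prop} (scalar : ∀ c, P (algebraMap K (A K) c))
    (gen : ∀ i, P (gen K i)) (mul : ∀ a b, P a → P b → P (a * b))
    (add : ∀ a b, P a → P b → P (a + b)) (a : A K) : P a := by
  obtain ⟨a, rfl⟩ := RingQuot.mkAlgHom_surjective K (MonRel K) a
  induction a using FreeAlgebra.induction with
  | grade0 c => simpa using scalar c
  | grade1 i => exact gen i
  | mul a b ha hb => simpa using mul _ _ ha hb
  | add a b ha hb => simpa using add _ _ ha hb

/-- An additive map commuting with scalars and generators is `A`-linear. -/
noncomputable def homOfGen {M N : ModuleCat.{0} (A K)} (φ : M →+ N)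
    (scalar : ∀ (c : K) (v : M), φ (algebraMap K (A K) c • v) = algebraMap K (A K) c • φ v)
    (hgen : ∀ (i : Gen) (v : M), φ (gen K i • v) = gen K i • φ v) : M ⟶ N :=
  ModuleCat.ofHom
    { φ with
      map_smul' := fun a => by
        dsimp
        induction a using A.induction with
        | scalar c => exact scalar c
        | gen i => exact hgen i
        | mul a b ha hb => intro v; rw [mul_smul, ha, hb, mul_smul]
        | add a b ha hb => intro v; rw [add_smul, map_add, ha, hb, add_smul] }

variable (K) in
/-- The endomorphism of `K^(n+1)` sending `e_j` to `e_(j+1)` if the `j`-th letter of `l` is `i`,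
and to `0` otherwise. -/
noncomputable def step {n : ℕ} (l : Fin n → Gen) (i : Gen) : Module.End K (Fin (n + 1) → K) where
  toFun v := Fin.cons 0 fun j => open Classical in if l j = i then v j.castSucc else 0
  map_add' v w := by
    ext j
    cases j using Fin.cases <;> simp
    split_ifs <;> simp
  map_smul' c v := by
    ext j
    cases j using Fin.cases <;> simp

open Classical in
theorem step_apply_succ {n : ℕ} (l : Fin n → Gen) (i : Gen) (v : Fin (n + 1) → K) (j : Fin n) :
    step K l i v j.succ = if l j = i then v j.castSucc else 0 := rfl

theorem step_apply_zero {n : ℕ} (l : Fin n → Gen) (i : Gen) (v : Fin (n + 1) → K) :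
    step K l i v 0 = 0 := rfl

theorem step_cons_zero {n : ℕ} (l : Fin (n + 1) → Gen) (i : Gen) (v : Fin (n + 1) → K) :
    step K l i (Fin.cons 0 v : Fin (n + 2) → K) = Fin.cons 0 (step K (Fin.tail l) i v) := by
  ext j
  cases j using Fin.cases with
  | zero => rfl
  | succ j =>
    rw [step_apply_succ, Fin.cons_succ]
    cases j using Fin.cases with
    | zero => simp [step_apply_zero]
    | succ j => rw [step_apply_succ, ← Fin.succ_castSucc, Fin.cons_succ]; rfl

theorem step_init {n : ℕ} (l : Fin (n + 1) → Gen) (i : Gen) (v : Fin (n + 2) → K) :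
    step K (Fin.init l) i (Fin.init v) = Fin.init (step K l i v) := by
  ext j
  cases j using Fin.cases <;> rfl

theorem step_eq_zero {n : ℕ} {l : Fin n → Gen} {i : Gen} (h : ∀ j, l j ≠ i) :
    step K l i = 0 := by
  ext1 v
  ext j
  cases j using Fin.cases <;> simp [step_apply_zero, step_apply_succ, h]

variable (K) in
/-- The letters of `l` are the successive steps of a chain of vectors forming an `A`-module. -/
def IsChainWord {n : ℕ} (l : Fin n → Gen) : Prop :=
  ∀ ⦃a b⦄, MonRel K a b → FreeAlgebra.lift K (step K l) a = FreeAlgebra.lift K (step K l) b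

/-- The `A`-module with basis `e_0, …, e_n` where the `j`-th letter of `l` sends
`e_j` to `e_(j+1)`. -/
noncomputable def chain {n : ℕ} {l : Fin n → Gen} (hl : IsChainWord K l) : ModuleCat.{0} (A K) :=
  letI : Module (A K) (Fin (n + 1) → K) :=
    Module.compHom _ (RingQuot.liftAlgHom K ⟨FreeAlgebra.lift K (step K l), hl⟩).toRingHom
  ModuleCat.of (A K) (Fin (n + 1) → K)

namespace chain

variable {n : ℕ} {l : Fin n → Gen} (hl : IsChainWord K l)

/-- The vector of `chain hl` with given coordinates. -/
def mk : (Fin (n + 1) → K) ≃+ chain hl := AddEquiv.refl _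

theorem gen_smul (i : Gen) (v : Fin (n + 1) → K) :
    gen K i • mk hl v = mk hl (step K l i v) := by
  change RingQuot.liftAlgHom K ⟨FreeAlgebra.lift K (step K l), hl⟩ (gen K i) v = step K l i v
  have h := RingQuot.liftAlgHom_mkAlgHom_apply K (FreeAlgebra.lift K (step K l)) hl (g K i)
  rw [g, FreeAlgebra.lift_ι_apply] at h
  exact congr($h v)

theorem scalar_smul (c : K) (v : Fin (n + 1) → K) :
    algebraMap K (A K) c • mk hl v = mk hl (c • v) := by
  change RingQuot.liftAlgHom K ⟨FreeAlgebra.lift K (step K l), hl⟩ (algebraMap K (A K) c) v = c • v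
  rw [AlgHom.commutes, Module.algebraMap_end_apply]

end chain

variable (K) in
/-- The element of the trivial module with given value. -/
def KMod.mk : K ≃+ KMod K := AddEquiv.refl _

theorem KMod.smul_mk (a : A K) (c : K) : a • KMod.mk K c = KMod.mk K (aug K a * c) := rfl

namespace chain

variable {n : ℕ}

/-- The projection of a chain module onto the trivial module at its top. -/
noncomputable def top {l : Fin n → Gen} (hl : IsChainWord K l) : chain hl ⟶ KMod K :=
  homOfGen ((KMod.mk K).toAddMonoidHom.comp
      ((Pi.evalAddMonoidHom (fun _ => K) 0).comp (mk hl).symm.toAddMonoidHom))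
    (fun c v => by
      obtain ⟨v, rfl⟩ := (mk hl).surjective v
      simp [scalar_smul, KMod.smul_mk])
    (fun i v => by
      obtain ⟨v, rfl⟩ := (mk hl).surjective v
      simp [gen_smul, KMod.smul_mk, aug_gen, step_apply_zero])

/-- The inclusion of the trivial module as the socle of a chain module. -/
noncomputable def bot {l : Fin n → Gen} (hl : IsChainWord K l) : KMod K ⟶ chain hl :=
  homOfGen ((mk hl).toAddMonoidHom.comp
      ((AddMonoidHom.single (fun _ : Fin (n + 1) => K) (Fin.last n)).comp
        (KMod.mk K).symm.toAddMonoidHom))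
    (fun c v => by
      obtain ⟨v, rfl⟩ := (KMod.mk K).surjective v
      simp [scalar_smul, KMod.smul_mk, ← Pi.single_smul])
    (fun i v => by
      obtain ⟨v, rfl⟩ := (KMod.mk K).surjective v
      simp only [KMod.smul_mk, aug_gen, zero_mul, map_zero, AddMonoidHom.comp_apply,
        AddEquiv.coe_toAddMonoidHom, AddEquiv.symm_apply_apply, gen_smul]
      rw [eq_comm, AddEquiv.map_eq_zero_iff]
      ext j
      cases j using Fin.cases <;>
        simp [step_apply_zero, step_apply_succ, (Fin.castSucc_lt_last _).ne])

/-- The inclusion of the submodule of a chain module spanned by all basis vectors but the first. -/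
noncomputable def incl {l : Fin (n + 1) → Gen} {l' : Fin n → Gen} (h : Fin.tail l = l')
    (hl : IsChainWord K l) (hl' : IsChainWord K l') : chain hl' ⟶ chain hl :=
  homOfGen
    ((mk hl).toAddMonoidHom.comp (AddMonoidHom.comp
      { toFun := fun v => Fin.cons 0 v
        map_zero' := by ext j; cases j using Fin.cases <;> simp
        map_add' := fun v w => by ext j; cases j using Fin.cases <;> simp }
      (mk hl').symm.toAddMonoidHom))
    (fun c v => by
      obtain ⟨v, rfl⟩ := (mk hl').surjective v
      simp only [scalar_smul, AddMonoidHom.comp_apply, AddEquiv.coe_toAddMonoidHom,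
        AddEquiv.symm_apply_apply, AddMonoidHom.coe_mk, ZeroHom.coe_mk]
      congr 1
      ext j; cases j using Fin.cases <;> simp)
    (fun i v => by
      obtain ⟨v, rfl⟩ := (mk hl').surjective v
      simp only [gen_smul, AddMonoidHom.comp_apply, AddEquiv.coe_toAddMonoidHom,
        AddEquiv.symm_apply_apply, AddMonoidHom.coe_mk, ZeroHom.coe_mk]
      rw [step_cons_zero, h])

/-- The quotient of a chain module by its socle. -/
noncomputable def proj {l : Fin (n + 1) → Gen} {l' : Fin n → Gen} (h : Fin.init l = l')
    (hl : IsChainWord K l) (hl' : IsChainWord K l') : chain hl ⟶ chain hl' :=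
  homOfGen
    ((mk hl').toAddMonoidHom.comp (AddMonoidHom.comp
      { toFun := fun v => Fin.init v
        map_zero' := rfl
        map_add' := fun v w => rfl }
      (mk hl).symm.toAddMonoidHom))
    (fun c v => by
      obtain ⟨v, rfl⟩ := (mk hl).surjective v
      simp only [scalar_smul, AddMonoidHom.comp_apply, AddEquiv.coe_toAddMonoidHom,
        AddEquiv.symm_apply_apply]
      rfl)
    (fun i v => by
      obtain ⟨v, rfl⟩ := (mk hl).surjective v
      simp only [gen_smul, AddMonoidHom.comp_apply, AddEquiv.coe_toAddMonoidHom,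
        AddEquiv.symm_apply_apply]
      exact congr(mk hl' $((h ▸ step_init l i v).symm)))

theorem top_mk {l : Fin n → Gen} (hl : IsChainWord K l) (v) :
    (top hl).hom (mk hl v) = KMod.mk K (v 0) := rfl

theorem bot_mk {l : Fin n → Gen} (hl : IsChainWord K l) (c) :
    (bot hl).hom (KMod.mk K c) = mk hl (Pi.single (Fin.last n) c) := rfl

theorem incl_mk {l : Fin (n + 1) → Gen} {l' : Fin n → Gen} (h : Fin.tail l = l')
    (hl : IsChainWord K l) (hl' : IsChainWord K l') (v) :
    (incl h hl hl').hom (mk hl' v) = mk hl (Fin.cons 0 v) := rfl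

theorem proj_mk {l : Fin (n + 1) → Gen} {l' : Fin n → Gen} (h : Fin.init l = l')
    (hl : IsChainWord K l) (hl' : IsChainWord K l') (v) :
    (proj h hl hl').hom (mk hl v) = mk hl' (Fin.init v) := rfl

theorem shortExact_incl_top {l : Fin (n + 1) → Gen} {l' : Fin n → Gen} (h : Fin.tail l = l')
    (hl : IsChainWord K l) (hl' : IsChainWord K l') :
    ∃ w, (ShortComplex.mk (incl h hl hl') (top hl) w).ShortExact := by
  refine ⟨?_, ?_⟩
  · ext v
    obtain ⟨v, rfl⟩ := (mk hl').surjective v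
    simp [incl_mk, top_mk]
  refine ModuleCat.shortComplex_shortExact _ (fun v => ⟨fun h => ?_, ?_⟩) ?_ ?_
  · obtain ⟨v, rfl⟩ := (mk hl).surjective v
    dsimp only at h ⊢
    rw [top_mk, AddEquiv.map_eq_zero_iff] at h
    refine ⟨mk hl' (Fin.tail v), ?_⟩
    rw [incl_mk, ← h, Fin.cons_self_tail]
  · rintro ⟨v, rfl⟩
    obtain ⟨v, rfl⟩ := (mk hl').surjective v
    dsimp only
    rw [incl_mk, top_mk]
    exact map_zero (KMod.mk K)
  · intro v w h
    obtain ⟨v, rfl⟩ := (mk hl').surjective v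
    obtain ⟨w, rfl⟩ := (mk hl').surjective w
    dsimp only at h
    rw [incl_mk, incl_mk, (mk hl).apply_eq_iff_eq] at h
    rw [(Fin.cons_injective2 h).2]
  · intro c
    obtain ⟨c, rfl⟩ := (KMod.mk K).surjective c
    exact ⟨mk hl fun _ => c, rfl⟩

theorem shortExact_bot_proj {l : Fin (n + 1) → Gen} {l' : Fin n → Gen} (h : Fin.init l = l')
    (hl : IsChainWord K l) (hl' : IsChainWord K l') :
    ∃ w, (ShortComplex.mk (bot hl) (proj h hl hl') w).ShortExact := by
  have hzero (c : KMod K) : (proj h hl hl').hom ((bot hl).hom c) = 0 := by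
    obtain ⟨c, rfl⟩ := (KMod.mk K).surjective c
    rw [bot_mk, proj_mk, AddEquiv.map_eq_zero_iff]
    ext j
    simp [Fin.init, (Fin.castSucc_lt_last j).ne]
  refine ⟨by ext c; exact hzero c, ?_⟩
  refine ModuleCat.shortComplex_shortExact _ (fun v => ⟨fun h => ?_, ?_⟩) ?_ ?_
  · obtain ⟨v, rfl⟩ := (mk hl).surjective v
    dsimp only at h ⊢
    rw [proj_mk, AddEquiv.map_eq_zero_iff] at h
    refine ⟨KMod.mk K (v (Fin.last _)), ?_⟩
    rw [bot_mk, (mk hl).apply_eq_iff_eq]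
    ext j
    cases j using Fin.lastCases with
    | last => simp
    | cast j => simpa [(Fin.castSucc_lt_last j).ne, Fin.init] using (congrFun h j).symm
  · rintro ⟨c, rfl⟩
    exact hzero c
  · intro c d h
    obtain ⟨c, rfl⟩ := (KMod.mk K).surjective c
    obtain ⟨d, rfl⟩ := (KMod.mk K).surjective d
    dsimp only at h
    rw [bot_mk, bot_mk, (mk hl).apply_eq_iff_eq] at h
    rw [Pi.single_injective _ h]
  · intro v
    obtain ⟨v, rfl⟩ := (mk hl').surjective v
    refine ⟨mk hl (Fin.snoc v 0), ?_⟩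
    dsimp only
    rw [proj_mk, Fin.init_snoc]

theorem shortExact_bot_top {l : Fin 1 → Gen} (hl : IsChainWord K l) :
    ∃ w, (ShortComplex.mk (bot hl) (top hl) w).ShortExact := by
  have hzero (c : KMod K) : (top hl).hom ((bot hl).hom c) = 0 := by
    obtain ⟨c, rfl⟩ := (KMod.mk K).surjective c
    rw [bot_mk, top_mk, AddEquiv.map_eq_zero_iff]
    simp
  refine ⟨by ext c; exact hzero c, ?_⟩
  refine ModuleCat.shortComplex_shortExact _ (fun v => ⟨fun h => ?_, ?_⟩) ?_ ?_
  · obtain ⟨v, rfl⟩ := (mk hl).surjective v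
    dsimp only at h ⊢
    rw [top_mk, AddEquiv.map_eq_zero_iff] at h
    refine ⟨KMod.mk K (v (Fin.last _)), ?_⟩
    rw [bot_mk, (mk hl).apply_eq_iff_eq]
    ext j
    fin_cases j <;> simp [h]
  · rintro ⟨c, rfl⟩
    exact hzero c
  · intro c d h
    obtain ⟨c, rfl⟩ := (KMod.mk K).surjective c
    obtain ⟨d, rfl⟩ := (KMod.mk K).surjective d
    dsimp only at h
    rw [bot_mk, bot_mk, (mk hl).apply_eq_iff_eq] at h
    rw [Pi.single_injective _ h]
  · intro c
    obtain ⟨c, rfl⟩ := (KMod.mk K).surjective c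
    exact ⟨mk hl fun _ => c, rfl⟩

open Classical in
theorem gen_smul_single {l : Fin n → Gen} (hl : IsChainWord K l) (i : Gen) (j : Fin n)
    (h : l j = i) (c : K) :
    gen K i • mk hl (Pi.single j.castSucc c) = mk hl (Pi.single j.succ c) := by
  rw [gen_smul, (mk hl).apply_eq_iff_eq]
  ext k
  cases k using Fin.cases with
  | zero => simp [step_apply_zero]
  | succ k =>
    rw [step_apply_succ]
    rcases eq_or_ne k j with rfl | hkj
    · simp [h]
    · simp [hkj]

end chain

theorem isChainWord_of_forall_ne {k : ℕ} {l : Fin k → Gen} (hn : ∀ j, l j ≠ n)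
    (hp : ∀ j, l j ≠ p) (hy : ∀ j, l j ≠ y) (hst : (∀ j, l j ≠ s) ∨ ∀ j, l j ≠ t)
    (htx : (∀ j, l j ≠ t) ∨ ∀ j, l j ≠ x) : IsChainWord K l := by
  intro a b h
  have hn := step_eq_zero (K := K) hn
  have hp := step_eq_zero (K := K) hp
  have hy := step_eq_zero (K := K) hy
  have hst := hst.imp (step_eq_zero (K := K)) (step_eq_zero (K := K))
  have htx := htx.imp (step_eq_zero (K := K)) (step_eq_zero (K := K))
  cases h <;> simp [g, hn, hp, hy]
  · rcases hst with h | h <;> simp [h]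
  · rcases htx with h | h <;> simp [h]

theorem tail_xwvu : Fin.tail (n := 3) ![x, w, v, u] = ![w, v, u] := rfl

theorem init_wvut : Fin.init (n := 3) ![w, v, u, t] = ![w, v, u] := by
  ext j
  fin_cases j <;> rfl

theorem isChainWord_xwvu : IsChainWord (n := 4) K ![x, w, v, u] := by
  apply isChainWord_of_forall_ne <;> simp [Fin.forall_fin_succ]

theorem isChainWord_wvut : IsChainWord (n := 4) K ![w, v, u, t] := by
  apply isChainWord_of_forall_ne <;> simp [Fin.forall_fin_succ]

theorem isChainWord_wvu : IsChainWord (n := 3) K ![w, v, u] := by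
  apply isChainWord_of_forall_ne <;> simp [Fin.forall_fin_succ]

theorem isChainWord_s : IsChainWord (n := 1) K ![s] := by
  apply isChainWord_of_forall_ne <;> simp

theorem gen_stu : gen K s * (gen K t * gen K u) = 0 := by
  simpa [gen, mul_assoc] using RingQuot.mkAlgHom_rel K (MonRel.stu (K := K))

theorem gen_tuvwx :
    gen K t * (gen K u * (gen K v * (gen K w * gen K x))) = 0 := by
  simpa [gen, mul_assoc] using RingQuot.mkAlgHom_rel K (MonRel.tuvwx (K := K))

/-- The morphism from the free module of rank one determined by an element. -/
noncomputable def homOfElement (M : ModuleCat.{0} (A K)) (v : M) : ModuleCat.of (A K) (A K) ⟶ M :=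
  ModuleCat.ofHom (LinearMap.toSpanSingleton (A K) M v)

end

/-- There exist `γ ∈ Extᴬ²(K,K)` and `e ∈ Extᴬ¹(K,K)` whose
Yoneda product `γe ∈ Extᴬ³(K,K)` is nonzero. -/
theorem statement_13 :
    ∃ (γ : E K 2) (e : E K 1), γ.comp e (by norm_num : 2 + 1 = 3) ≠ 0 := by
  obtain ⟨w₀, h₀⟩ := chain.shortExact_incl_top tail_xwvu (isChainWord_xwvu (K := K)) isChainWord_wvu
  obtain ⟨w₁, h₁⟩ := chain.shortExact_bot_proj init_wvut (isChainWord_wvut (K := K)) isChainWord_wvu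
  obtain ⟨w₂, h₂⟩ := chain.shortExact_bot_top (isChainWord_s (K := K))
  refine ⟨h₀.extClass.comp h₁.extClass (by norm_num : 1 + 1 = 2), h₂.extClass, fun hzero => ?_⟩
  have : Mono (chain.incl tail_xwvu (isChainWord_xwvu (K := K)) isChainWord_wvu) := h₀.mono_f
  have : Mono (chain.bot (isChainWord_wvut (K := K))) := h₁.mono_f
  let ρ : A K →ₗ[A K] A K := LinearMap.toSpanSingleton (A K) (A K) (gen K x)
  let j : ModuleCat.of (A K) ρ.ker ⟶ ModuleCat.of (A K) (A K) := ModuleCat.ofHom ρ.ker.subtype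
  let q : ModuleCat.of (A K) (A K) ⟶ ModuleCat.of (A K) ρ.range :=
    ModuleCat.ofHom ρ.rangeRestrict
  have hjq : j ≫ q = 0 := by
    ext a : 2
    exact Subtype.ext (LinearMap.mem_ker.1 a.2)
  have h : (ShortComplex.mk j q hjq).ShortExact := by
    refine ModuleCat.shortComplex_shortExact _ (fun a => ⟨fun ha => ?_, ?_⟩)
      Subtype.val_injective ρ.surjective_rangeRestrict
    · exact ⟨⟨a, congr(Subtype.val $ha)⟩, rfl⟩
    · rintro ⟨a, rfl⟩
      exact Subtype.ext (LinearMap.mem_ker.1 a.2)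
  let a : ModuleCat.of (A K) ρ.range ⟶ ModuleCat.of (A K) (A K) :=
    ModuleCat.ofHom ρ.range.subtype
  let v₀ : chain isChainWord_xwvu := chain.mk (isChainWord_xwvu (K := K)) (Pi.single 0 1)
  let v₁ : chain isChainWord_wvut := chain.mk (isChainWord_wvut (K := K)) (Pi.single 0 1)
  let b : ModuleCat.of (A K) (A K) ⟶ chain isChainWord_xwvu :=
    homOfElement (chain isChainWord_xwvu) v₀
  let ψ : ModuleCat.of (A K) (A K) ⟶ chain isChainWord_wvut :=
    homOfElement (chain isChainWord_wvut) v₁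
  have hab : (a ≫ b) ≫ chain.top isChainWord_xwvu = 0 := by
    ext ⟨_, c, rfl⟩
    change (chain.top _).hom ((c * gen K x) • v₀) = 0
    rw [map_smul, chain.top_mk, KMod.smul_mk, map_mul (aug K), aug_gen, mul_zero, zero_mul, map_zero]
  let f : ModuleCat.of (A K) ρ.range ⟶ chain isChainWord_wvu := h₀.exact.lift (a ≫ b) hab
  have hf : f ≫ chain.incl tail_xwvu isChainWord_xwvu isChainWord_wvu = a ≫ b := h₀.exact.lift_f _ _
  have hψ : ψ ≫ chain.proj init_wvut isChainWord_wvut isChainWord_wvu = q ≫ f := by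
    rw [← cancel_mono (chain.incl tail_xwvu isChainWord_xwvu isChainWord_wvu), Category.assoc q, hf]
    have hbase : (chain.incl tail_xwvu isChainWord_xwvu isChainWord_wvu).hom
        ((chain.proj init_wvut isChainWord_wvut isChainWord_wvu).hom v₁) = gen K x • v₀ := by
      rw [chain.proj_mk, chain.incl_mk]
      refine Eq.trans (congrArg _ ?_)
        (chain.gen_smul_single isChainWord_xwvu x 0 rfl 1).symm
      ext k
      fin_cases k <;> rfl
    refine ModuleCat.hom_ext (LinearMap.ext fun c => ?_)
    change (chain.incl tail_xwvu isChainWord_xwvu isChainWord_wvu).hom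
      ((chain.proj init_wvut isChainWord_wvut isChainWord_wvu).hom (c • v₁)) = (c * gen K x) • v₀
    rw [map_smul, map_smul, hbase, mul_smul]
  let φ : ModuleCat.of (A K) ρ.ker ⟶ KMod K :=
    h₁.exact.lift (j ≫ ψ) (by
      dsimp only
      rw [Category.assoc, hψ, ← Category.assoc, hjq, Limits.zero_comp])
  have hφ : φ ≫ chain.bot isChainWord_wvut = j ≫ ψ := h₁.exact.lift_f _ _
  have : Projective (ModuleCat.of (A K) (A K)) := inferInstance
  obtain ⟨χ, hχ⟩ := exists_lift_of_extClass_comp_eq_zero h₀ h₁ h₂ h a b φ ψ f hφ hψ hf hzero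
  let τ : ρ.ker := ⟨gen K t * (gen K u * (gen K v * gen K w)), by
    rw [LinearMap.mem_ker, LinearMap.toSpanSingleton_apply, smul_eq_mul, mul_assoc, mul_assoc,
      mul_assoc, gen_tuvwx]⟩
  have hτ : gen K s • τ = 0 := by
    ext1
    change gen K s * (gen K t * (gen K u * (gen K v * gen K w))) = 0
    rw [← mul_assoc (gen K t), ← mul_assoc (gen K s), gen_stu, zero_mul]
  have hφτ : φ.hom τ ≠ 0 := by
    intro h0
    have h1 : (chain.bot isChainWord_wvut).hom (φ.hom τ) =
        (gen K t * (gen K u * (gen K v * gen K w))) • v₁ := congr(($hφ).hom τ)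
    have e₀ := chain.gen_smul_single (isChainWord_wvut (K := K)) w 0 rfl 1
    have e₁ := chain.gen_smul_single (isChainWord_wvut (K := K)) v 1 rfl 1
    have e₂ := chain.gen_smul_single (isChainWord_wvut (K := K)) u 2 rfl 1
    have e₃ := chain.gen_smul_single (isChainWord_wvut (K := K)) t 3 rfl 1
    have h2 : (gen K t * (gen K u * (gen K v * gen K w))) • v₁ =
        chain.mk isChainWord_wvut (Pi.single (Fin.succ 3) 1) := by
      rw [mul_smul, mul_smul, mul_smul]
      exact congr(gen K t • gen K u • gen K v • $e₀).trans
        (congr(gen K t • gen K u • $e₁).trans (congr(gen K t • $e₂).trans e₃))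
    rw [h0, map_zero, h2, eq_comm, AddEquiv.map_eq_zero_iff] at h1
    simpa using congrFun h1 (Fin.succ 3)
  apply hφτ
  obtain ⟨c, hc⟩ := (chain.mk (isChainWord_s (K := K))).surjective (χ.hom τ)
  have h1 : (chain.top isChainWord_s).hom (χ.hom τ) = φ.hom τ := congr(($hχ).hom τ)
  have h2 : gen K s • χ.hom τ = 0 := by
    rw [← map_smul]
    exact (congrArg _ hτ).trans (map_zero _)
  rw [← hc, chain.gen_smul, AddEquiv.map_eq_zero_iff] at h2
  have h3 := congrFun h2 (Fin.succ 0)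
  rw [step_apply_succ, if_pos (by rfl)] at h3
  rw [← h1, ← hc, chain.top_mk]
  exact congr(KMod.mk K $h3)
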